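/- For every C > 0 and every ε > 0 there exist ε₀ > 0, δ > 0 and N such that the following holds for all n ≥ N, all integers k with |k − 2·log₂ n| ≤ C·log log n and C(n,k)·2^{−C(k,2)} ≤ n^{1+δ}, all integers r with 2 ≤ r ≤ ε₀·(log log n)/(log log log n), and all integers μ, ρ, β with 0 ≤ μ < r, 0 ≤ ρ ≤ r−2, β ≤ r² and β > 1 + (μ+1)ρ. Let ℰ be the event that in G_{n,1/2} there exist a vertex set A with |A| = k − ρ inducing at most k^{3/4} edges, and induced edges e₁, …, e_β each with both endpoints outside A, such that: (1) each e_i is an edge induced by a (k+1)-element vertex set A_i that induces at most k^{3/4} edges and satisfies A ∩ A_i = ∅; (2) for i ≠ ℓ, the sets A_i and A_ℓ are either equal or disjoint; (3) each set A_i contains at most μ of the edges e₁, …, e_β; and (4) for each i, at most k^{2/3} vertices of A are adjacent to both endpoints of e_i. Then P(ℰ) ≤ n^{−1/8+ε}. -/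

import Mathlib

open scoped Classical

/-- Probability of an event under the uniform measure on simple graphs on `Fin n`
(equivalently, `G_{n,1/2}`). -/
noncomputable def grPr (n : ℕ) (S : Set (SimpleGraph (Fin n))) : ℝ :=
  ((PMF.uniformOfFintype (SimpleGraph (Fin n))).toOuterMeasure S).toReal

/-- Number of edges of `G` with both endpoints in `s`. -/
noncomputable def edgesIn {n : ℕ} (G : SimpleGraph (Fin n)) (s : Finset (Fin n)) : ℕ :=
  {e ∈ G.edgeSet | ∀ v ∈ e, v ∈ s}.ncard

/-- `E[Y_k] = C(n,k)·2^{-C(k,2)}`. -/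
noncomputable def expY (n k : ℕ) : ℝ := (n.choose k : ℝ) / 2 ^ (k.choose 2)

/-- The event `ℰ = ℰ_{μ,ρ,β}`: there are a light `(k-ρ)`-set `A` and `β` distinct
defects `e₁,…,e_β` (edges with both endpoints outside `A`, given by their endpoints
`u i`, `v i`), each contained in a light `(k+1)`-set `A i` disjoint from `A`, the
`A i` pairwise equal or disjoint, each `A i` containing at most `μ` of the defects,
and each defect forming a triangle with at most `k^{2/3}` vertices of `A`. -/
def BadCoverEvent (n k μ ρ β : ℕ) (G : SimpleGraph (Fin n)) : Prop :=
  ∃ A : Finset (Fin n), A.card = k - ρ ∧ (edgesIn G A : ℝ) ≤ (k : ℝ) ^ (3 / 4 : ℝ) ∧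
    ∃ (As : Fin β → Finset (Fin n)) (u v : Fin β → Fin n),
      (∀ i, G.Adj (u i) (v i) ∧ u i ∉ A ∧ v i ∉ A) ∧
      (∀ i ℓ, i ≠ ℓ → s(u i, v i) ≠ s(u ℓ, v ℓ)) ∧
      (∀ i, u i ∈ As i ∧ v i ∈ As i ∧ (As i).card = k + 1 ∧
        (edgesIn G (As i) : ℝ) ≤ (k : ℝ) ^ (3 / 4 : ℝ) ∧ Disjoint A (As i)) ∧
      (∀ i ℓ, As i = As ℓ ∨ Disjoint (As i) (As ℓ)) ∧
      (∀ i, ((Finset.univ.filter (fun ℓ : Fin β => u ℓ ∈ As i ∧ v ℓ ∈ As i)).card ≤ μ)) ∧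
      (∀ i, ((A.filter (fun w => G.Adj w (u i) ∧ G.Adj w (v i))).card : ℝ) ≤
        (k : ℝ) ^ (2 / 3 : ℝ))

section Probability

variable {n : ℕ}

lemma grPr_eq_ncard (X : Set (SimpleGraph (Fin n))) :
    grPr n X = (X.ncard : ℝ) / (Fintype.card (SimpleGraph (Fin n)) : ℝ) := by
  unfold grPr
  rw [PMF.toOuterMeasure_uniformOfFintype_apply, ENNReal.toReal_div, ENNReal.toReal_natCast,
    ENNReal.toReal_natCast, ← Nat.card_eq_fintype_card, Nat.card_coe_set_eq]

lemma card_simpleGraph_pos : (0 : ℝ) < (Fintype.card (SimpleGraph (Fin n)) : ℝ) := by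
  exact_mod_cast Fintype.card_pos

lemma grPr_nonneg (X : Set (SimpleGraph (Fin n))) : 0 ≤ grPr n X :=
  ENNReal.toReal_nonneg

lemma grPr_mono {X Y : Set (SimpleGraph (Fin n))} (h : X ⊆ Y) : grPr n X ≤ grPr n Y := by
  rw [grPr_eq_ncard, grPr_eq_ncard]
  have := Set.ncard_le_ncard h (Set.toFinite Y)
  gcongr

lemma grPr_univ : grPr n Set.univ = 1 := by
  rw [grPr_eq_ncard, Set.ncard_univ, Nat.card_eq_fintype_card]
  exact div_self card_simpleGraph_pos.ne'

lemma grPr_empty : grPr n ∅ = 0 := by simp [grPr_eq_ncard]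

lemma grPr_compl (X : Set (SimpleGraph (Fin n))) : grPr n Xᶜ = 1 - grPr n X := by
  have h := Set.ncard_add_ncard_compl X
  rw [Nat.card_eq_fintype_card] at h
  have h' : (X.ncard : ℝ) + (Xᶜ.ncard : ℝ) = Fintype.card (SimpleGraph (Fin n)) := by
    exact_mod_cast h
  rw [grPr_eq_ncard, grPr_eq_ncard, eq_sub_iff_add_eq, ← add_div, add_comm, h']
  exact div_self card_simpleGraph_pos.ne'

lemma grPr_union_le (X Y : Set (SimpleGraph (Fin n))) :
    grPr n (X ∪ Y) ≤ grPr n X + grPr n Y := by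
  simp only [grPr_eq_ncard]
  rw [← add_div]
  have := Set.ncard_union_le X Y
  gcongr
  exact_mod_cast this

lemma grPr_biUnion_le {ι : Type*} (I : Finset ι) (Y : ι → Set (SimpleGraph (Fin n))) :
    grPr n (⋃ i ∈ I, Y i) ≤ ∑ i ∈ I, grPr n (Y i) := by
  induction I using Finset.induction_on with
  | empty => simp [grPr_empty]
  | insert a s ha ih =>
    rw [Finset.set_biUnion_insert, Finset.sum_insert ha]
    exact (grPr_union_le _ _).trans (by gcongr)

/-- A union bound in which all the events have probability at most `c`. -/
lemma grPr_le_card_mul {ι : Type*} (I : Finset ι) (Y : ι → Set (SimpleGraph (Fin n)))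
    (X : Set (SimpleGraph (Fin n))) (c : ℝ) (hX : ∀ G ∈ X, ∃ i ∈ I, G ∈ Y i)
    (hY : ∀ i ∈ I, grPr n (Y i) ≤ c) : grPr n X ≤ I.card * c := by
  refine (grPr_mono (Y := ⋃ i ∈ I, Y i) fun G hG => ?_).trans
    ((grPr_biUnion_le I Y).trans ?_)
  · simpa using hX G hG
  · simpa using Finset.sum_le_card_nsmul I _ c hY

/-- The event `X` is determined by which of the pairs in `D` are edges. -/
def DeterminedBy (X : Set (SimpleGraph (Fin n))) (D : Set (Sym2 (Fin n))) : Prop :=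
  ∀ G H : SimpleGraph (Fin n), (∀ e ∈ D, e ∈ G.edgeSet ↔ e ∈ H.edgeSet) → (G ∈ X ↔ H ∈ X)

lemma DeterminedBy.mono {X : Set (SimpleGraph (Fin n))} {D D' : Set (Sym2 (Fin n))}
    (h : DeterminedBy X D) (hD : D ⊆ D') : DeterminedBy X D' :=
  fun G H hGH => h G H fun e he => hGH e (hD he)

lemma DeterminedBy.inter {X Y : Set (SimpleGraph (Fin n))} {D : Set (Sym2 (Fin n))}
    (hX : DeterminedBy X D) (hY : DeterminedBy Y D) : DeterminedBy (X ∩ Y) D :=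
  fun G H h => and_congr (hX G H h) (hY G H h)

lemma DeterminedBy.compl {X : Set (SimpleGraph (Fin n))} {D : Set (Sym2 (Fin n))}
    (hX : DeterminedBy X D) : DeterminedBy Xᶜ D :=
  fun G H h => not_congr (hX G H h)

lemma DeterminedBy.biInter {ι : Type*} {I : Set ι} {X : ι → Set (SimpleGraph (Fin n))}
    {D : Set (Sym2 (Fin n))} (h : ∀ i ∈ I, DeterminedBy (X i) D) :
    DeterminedBy (⋂ i ∈ I, X i) D := by
  intro G H hGH
  simp only [Set.mem_iInter]
  exact forall₂_congr fun i hi => h i hi G H hGH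

/-- The graph agreeing with `G` on the pairs in `D` and with `H` elsewhere. -/
def spliceGraph (D : Set (Sym2 (Fin n))) (G H : SimpleGraph (Fin n)) : SimpleGraph (Fin n) :=
  SimpleGraph.fromEdgeSet ((G.edgeSet ∩ D) ∪ (H.edgeSet \ D))

lemma mem_edgeSet_spliceGraph (D : Set (Sym2 (Fin n))) (G H : SimpleGraph (Fin n))
    (e : Sym2 (Fin n)) : e ∈ (spliceGraph D G H).edgeSet ↔
      (e ∈ G.edgeSet ∧ e ∈ D) ∨ (e ∈ H.edgeSet ∧ e ∉ D) := by
  have hG := G.not_isDiag_of_mem_edgeSet (e := e)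
  have hH := H.not_isDiag_of_mem_edgeSet (e := e)
  simp only [spliceGraph, SimpleGraph.edgeSet_fromEdgeSet, Set.mem_sdiff, Set.mem_union,
    Set.mem_inter_iff, Sym2.mem_diagSet]
  tauto

lemma spliceGraph_spliceGraph (D : Set (Sym2 (Fin n))) (G H : SimpleGraph (Fin n)) :
    spliceGraph D (spliceGraph D G H) (spliceGraph D H G) = G := by
  apply SimpleGraph.edgeSet_injective
  ext e
  simp only [mem_edgeSet_spliceGraph]
  tauto

/-- Events determined by disjoint sets of pairs are independent. -/
lemma grPr_inter_eq_mul {X Y : Set (SimpleGraph (Fin n))} {D D' : Set (Sym2 (Fin n))}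
    (hX : DeterminedBy X D) (hY : DeterminedBy Y D') (hD : Disjoint D D') :
    grPr n (X ∩ Y) = grPr n X * grPr n Y := by
  let φ : SimpleGraph (Fin n) × SimpleGraph (Fin n) → SimpleGraph (Fin n) × SimpleGraph (Fin n) :=
    fun p => (spliceGraph D p.1 p.2, spliceGraph D p.2 p.1)
  have hφ : Function.Involutive φ := fun p => by
    simp only [φ, spliceGraph_spliceGraph]
  have key : φ ⁻¹' ((X ∩ Y) ×ˢ Set.univ) = X ×ˢ Y := by
    ext ⟨G, H⟩
    have h1 : spliceGraph D G H ∈ X ↔ G ∈ X := hX _ _ fun e he => by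
      rw [mem_edgeSet_spliceGraph]; tauto
    have h2 : spliceGraph D G H ∈ Y ↔ H ∈ Y := hY _ _ fun e he => by
      have : e ∉ D := fun h => Set.disjoint_left.mp hD h he
      rw [mem_edgeSet_spliceGraph]; tauto
    simp only [φ, Set.mem_preimage, Set.mem_prod, Set.mem_inter_iff, Set.mem_univ, and_true,
      h1, h2]
  have hcard : ((X ∩ Y) ×ˢ (Set.univ : Set (SimpleGraph (Fin n)))).ncard = (X ×ˢ Y).ncard := by
    rw [← key, ← hφ.image_eq_preimage_symm, Set.ncard_image_of_injective _ hφ.injective]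
  rw [Set.ncard_prod, Set.ncard_prod, Set.ncard_univ, Nat.card_eq_fintype_card] at hcard
  have hcard' : ((X ∩ Y).ncard : ℝ) * Fintype.card (SimpleGraph (Fin n)) = X.ncard * Y.ncard := by
    exact_mod_cast hcard
  have hpos := card_simpleGraph_pos (n := n)
  rw [grPr_eq_ncard, grPr_eq_ncard, grPr_eq_ncard]
  field_simp
  linarith

lemma grPr_biInter_eq_prod {ι : Type*} (I : Finset ι) (X : ι → Set (SimpleGraph (Fin n)))
    (D : ι → Set (Sym2 (Fin n))) (hX : ∀ i ∈ I, DeterminedBy (X i) (D i))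
    (hD : (I : Set ι).PairwiseDisjoint D) :
    grPr n (⋂ i ∈ I, X i) = ∏ i ∈ I, grPr n (X i) := by
  induction I using Finset.induction_on with
  | empty => simp [grPr_univ]
  | insert a s ha ih =>
    rw [Finset.set_biInter_insert, Finset.prod_insert ha]
    have hs : DeterminedBy (⋂ i ∈ s, X i) (⋃ i ∈ s, D i) :=
      DeterminedBy.biInter fun i hi => (hX i (Finset.mem_insert_of_mem hi)).mono
        (Set.subset_biUnion_of_mem (u := D) hi)
    rw [grPr_inter_eq_mul (hX a (Finset.mem_insert_self a s)) hs,
      ih (fun i hi => hX i (Finset.mem_insert_of_mem hi))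
        (hD.subset (by simp))]
    rw [Set.disjoint_iUnion₂_right]
    intro i hi
    exact hD (by simp) (by simp [hi]) (by rintro rfl; exact ha hi)

lemma determinedBy_mem_edgeSet (e : Sym2 (Fin n)) :
    DeterminedBy {G | e ∈ G.edgeSet} {e} := fun _ _ h => h e rfl

/-- Each pair is an edge with probability `1/2`. -/
lemma grPr_mem_edgeSet {e : Sym2 (Fin n)} (he : ¬ e.IsDiag) :
    grPr n {G | e ∈ G.edgeSet} = 1 / 2 := by
  let φ : SimpleGraph (Fin n) → SimpleGraph (Fin n) :=
    fun G => symmDiff G (SimpleGraph.fromEdgeSet {e})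
  have hφ : Function.Involutive φ := fun G => symmDiff_symmDiff_cancel_right _ _
  have key : φ ⁻¹' {G | e ∈ G.edgeSet} = {G | e ∈ G.edgeSet}ᶜ := by
    ext G
    induction e with
    | _ x y =>
    simp only [Sym2.mk_isDiag_iff] at he
    simp [φ, symmDiff, he]
  have h1 : grPr n {G | e ∈ G.edgeSet}ᶜ = grPr n {G | e ∈ G.edgeSet} := by
    rw [← key, ← hφ.image_eq_preimage_symm, grPr_eq_ncard, grPr_eq_ncard,
      Set.ncard_image_of_injective _ hφ.injective]
  rw [grPr_compl] at h1
  linarith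

lemma grPr_mem_edgeSet_iff {e : Sym2 (Fin n)} (he : ¬ e.IsDiag) (p : Prop) :
    grPr n {G | e ∈ G.edgeSet ↔ p} = 1 / 2 := by
  by_cases hp : p
  · simpa [hp] using grPr_mem_edgeSet he
  · have := grPr_compl {G : SimpleGraph (Fin n) | e ∈ G.edgeSet}
    rw [grPr_mem_edgeSet he] at this
    simp only [hp, iff_false]
    rw [show {G : SimpleGraph (Fin n) | e ∉ G.edgeSet} = {G | e ∈ G.edgeSet}ᶜ from rfl, this]
    norm_num

/-- The pairs with both endpoints in `s`. -/
def insidePairs (s : Finset (Fin n)) : Set (Sym2 (Fin n)) := {e | ∀ v ∈ e, v ∈ s}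

/-- The pairs with one endpoint in `A` and the other in `B`. -/
def crossPairs (A B : Finset (Fin n)) : Set (Sym2 (Fin n)) := {e | ∃ a ∈ A, ∃ b ∈ B, e = s(a, b)}

lemma determinedBy_edgesIn_le (s : Finset (Fin n)) (κ : ℕ) :
    DeterminedBy {G | edgesIn G s ≤ κ} (insidePairs s) := by
  intro G H h
  have : {e ∈ G.edgeSet | ∀ v ∈ e, v ∈ s} = {e ∈ H.edgeSet | ∀ v ∈ e, v ∈ s} := by
    ext e
    exact and_congr_left fun he => h e he
  simp only [Set.mem_ofPred_eq, edgesIn, this]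

lemma card_powerset_filter_card_le {α : Type*} (P : Finset α) (κ : ℕ) :
    (P.powerset.filter fun L => L.card ≤ κ).card ≤ (P.card + 1) ^ κ := by
  have h : (P.powerset.filter fun L => L.card ≤ κ) ⊆
      (Finset.range (κ + 1)).biUnion fun i => P.powersetCard i := by
    intro L hL
    simp only [Finset.mem_filter, Finset.mem_powerset] at hL
    simp only [Finset.mem_biUnion, Finset.mem_range, Finset.mem_powersetCard]
    exact ⟨L.card, by lia, hL.1, rfl⟩
  calc _ ≤ _ := Finset.card_le_card h
    _ ≤ ∑ i ∈ Finset.range (κ + 1), (P.powersetCard i).card := Finset.card_biUnion_le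
    _ ≤ ∑ i ∈ Finset.range (κ + 1), P.card ^ i * 1 ^ (κ - i) * κ.choose i := by
        gcongr with i hi
        rw [Finset.card_powersetCard, one_pow, mul_one]
        have hi' : i ≤ κ := by simpa [Nat.lt_succ_iff] using hi
        exact (Nat.choose_le_pow _ _).trans (Nat.le_mul_of_pos_right _ (Nat.choose_pos hi'))
    _ = _ := (add_pow _ _ _).symm

lemma grPr_edgesIn_le (s : Finset (Fin n)) (κ : ℕ) :
    grPr n {G | edgesIn G s ≤ κ} ≤
      ((s.card.choose 2 + 1 : ℕ) : ℝ) ^ κ * (1 / 2) ^ (s.card.choose 2) := by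
  set P : Finset (Sym2 (Fin n)) := s.offDiag.image Sym2.mk.uncurry with hP
  have hPcard : P.card = s.card.choose 2 := Sym2.card_image_offDiag s
  have hPmem : ∀ e ∈ P, ¬ e.IsDiag := by
    intro e he
    simp only [hP, Finset.mem_image, Finset.mem_offDiag, Prod.exists] at he
    obtain ⟨x, y, ⟨_, _, hxy⟩, rfl⟩ := he
    simpa using hxy
  have hc : ∀ L : Finset (Sym2 (Fin n)),
      grPr n (⋂ e ∈ P, {G | e ∈ G.edgeSet ↔ e ∈ L}) = (1 / 2) ^ (s.card.choose 2) := by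
    intro L
    rw [grPr_biInter_eq_prod P _ (fun e => {e})]
    · rw [Finset.prod_congr rfl fun e he => grPr_mem_edgeSet_iff (hPmem e he) (e ∈ L)]
      rw [Finset.prod_const, hPcard]
    · intro e _ G H h
      simp only [Set.mem_ofPred_eq, h e rfl]
    · intro e _ e' _ hne
      simpa using hne
  have hmain := grPr_le_card_mul (n := n) (P.powerset.filter fun L => L.card ≤ κ)
    (fun L => ⋂ e ∈ P, {G | e ∈ G.edgeSet ↔ e ∈ L}) {G | edgesIn G s ≤ κ}
    ((1 / 2) ^ (s.card.choose 2)) ?_ (fun L _ => (hc L).le)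
  · refine hmain.trans ?_
    gcongr
    rw [← hPcard]
    exact_mod_cast card_powerset_filter_card_le P κ
  · intro G hG
    refine ⟨P.filter (· ∈ G.edgeSet), ?_, ?_⟩
    · simp only [Finset.mem_filter, Finset.mem_powerset]
      refine ⟨Finset.filter_subset _ _, le_trans ?_ hG⟩
      rw [edgesIn, ← Set.ncard_coe_finset]
      refine Set.ncard_le_ncard ?_ (Set.toFinite _)
      intro e he
      simp only [Finset.coe_filter, Set.mem_ofPred_eq] at he
      refine ⟨he.2, ?_⟩
      have h1 := he.1
      simp only [hP, Finset.mem_image, Finset.mem_offDiag, Prod.exists] at h1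
      obtain ⟨x, y, ⟨hx, hy, hxy⟩, rfl⟩ := h1
      intro v hv
      simp only [Function.uncurry_apply_pair, Sym2.mem_iff] at hv
      rcases hv with rfl | rfl <;> assumption
    · simp only [Set.mem_iInter, Set.mem_ofPred_eq, Finset.mem_filter]
      intro e he
      tauto

/-- The vertex `a` forms a triangle with neither of the pairs `xy`, `zw`. -/
def NoCommon (a x y z w : Fin n) (G : SimpleGraph (Fin n)) : Prop :=
  ¬ (G.Adj a x ∧ G.Adj a y) ∧ ¬ (G.Adj a z ∧ G.Adj a w)

/-- At most `τ` vertices of `A` are adjacent to both `x` and `y`. -/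
def FewCommon (A : Finset (Fin n)) (τ : ℕ) (x y : Fin n) (G : SimpleGraph (Fin n)) : Prop :=
  (A.filter fun a => G.Adj a x ∧ G.Adj a y).card ≤ τ

lemma determinedBy_noCommon {a x y z w : Fin n} {B : Finset (Fin n)}
    (hx : x ∈ B) (hy : y ∈ B) (hz : z ∈ B) (hw : w ∈ B) :
    DeterminedBy {G | NoCommon a x y z w G} (crossPairs {a} B) := by
  intro G H h
  have h' : ∀ b ∈ B, (G.Adj a b ↔ H.Adj a b) := fun b hb =>
    h s(a, b) ⟨a, by simp, b, hb, rfl⟩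
  simp only [Set.mem_ofPred_eq, NoCommon, h' x hx, h' y hy, h' z hz, h' w hw]

lemma determinedBy_fewCommon {A B : Finset (Fin n)} {x y : Fin n} (τ : ℕ)
    (hx : x ∈ B) (hy : y ∈ B) : DeterminedBy {G | FewCommon A τ x y G} (crossPairs A B) := by
  intro G H h
  have h' : ∀ a ∈ A, ∀ b ∈ B, (G.Adj a b ↔ H.Adj a b) := fun a ha b hb =>
    h s(a, b) ⟨a, ha, b, hb, rfl⟩
  simp only [Set.mem_ofPred_eq, FewCommon]
  rw [Finset.filter_congr fun a ha => by rw [h' a ha x hx, h' a ha y hy]]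

lemma grPr_fewCommon_le {A B : Finset (Fin n)} {x y z w : Fin n} (τ : ℕ) {q : ℝ} (hq0 : 0 ≤ q)
    (hq1 : q ≤ 1) (hx : x ∈ B) (hy : y ∈ B) (hz : z ∈ B) (hw : w ∈ B) (hAB : Disjoint A B)
    (hq : ∀ a ∈ A, grPr n {G | NoCommon a x y z w G} ≤ q) :
    grPr n {G | FewCommon A τ x y G ∧ FewCommon A τ z w G} ≤
      ((A.card + 1 : ℕ) : ℝ) ^ (2 * τ) * q ^ (A.card - 2 * τ) := by
  refine (grPr_le_card_mul (A.powerset.filter fun S => S.card ≤ 2 * τ)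
    (fun S => ⋂ a ∈ A \ S, {G | NoCommon a x y z w G}) _ (q ^ (A.card - 2 * τ)) ?_ ?_).trans ?_
  · rintro G ⟨h1, h2⟩
    refine ⟨(A.filter fun a => G.Adj a x ∧ G.Adj a y) ∪ (A.filter fun a => G.Adj a z ∧ G.Adj a w),
      ?_, ?_⟩
    · simp only [Finset.mem_filter, Finset.mem_powerset]
      refine ⟨Finset.union_subset (Finset.filter_subset _ _) (Finset.filter_subset _ _), ?_⟩
      refine (Finset.card_union_le _ _).trans ?_
      unfold FewCommon at h1 h2
      lia
    · simp only [Set.mem_iInter, Finset.mem_sdiff, Finset.mem_union, Finset.mem_filter,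
        Set.mem_ofPred_eq, NoCommon]
      tauto
  · intro S hS
    simp only [Finset.mem_filter, Finset.mem_powerset] at hS
    rw [grPr_biInter_eq_prod _ _ (fun a => crossPairs {a} B)
      (fun a _ => determinedBy_noCommon hx hy hz hw)]
    · calc _ ≤ ∏ a ∈ A \ S, q := Finset.prod_le_prod (fun a _ => grPr_nonneg _)
            (fun a ha => hq a (Finset.mem_sdiff.mp ha).1)
        _ = q ^ (A \ S).card := Finset.prod_const q
        _ ≤ _ := by
          apply pow_le_pow_of_le_one hq0 hq1
          rw [Finset.card_sdiff_of_subset hS.1]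
          lia
    · intro a ha a' ha' hne
      simp only [Finset.coe_sdiff, Set.mem_sdiff, Finset.mem_coe] at ha ha'
      rw [Function.onFun, Set.disjoint_left]
      rintro e ⟨a₁, h₁, b, hb, rfl⟩ ⟨a₂, h₂, b', hb', he⟩
      rw [Finset.mem_singleton] at h₁ h₂
      subst h₁ h₂
      rw [Sym2.eq_iff] at he
      rcases he with ⟨h, _⟩ | ⟨h, _⟩
      · exact hne h
      · exact Finset.disjoint_left.mp hAB ha.1 (h ▸ hb')
  · gcongr
    exact_mod_cast card_powerset_filter_card_le A (2 * τ)

/-- A light set `B` containing a quadruple satisfying `V` whose two pairs form few triangles with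
`A`. -/
def BlockEvent (V : Fin n → Fin n → Fin n → Fin n → Prop) (A : Finset (Fin n)) (κ τ : ℕ)
    (B : Finset (Fin n)) (G : SimpleGraph (Fin n)) : Prop :=
  edgesIn G B ≤ κ ∧ ∃ x ∈ B, ∃ y ∈ B, ∃ z ∈ B, ∃ w ∈ B, V x y z w ∧
    FewCommon A τ x y G ∧ FewCommon A τ z w G

lemma determinedBy_exists_fewCommon (V : Fin n → Fin n → Fin n → Fin n → Prop)
    (A : Finset (Fin n)) (τ : ℕ) (B : Finset (Fin n)) :
    DeterminedBy {G | ∃ x ∈ B, ∃ y ∈ B, ∃ z ∈ B, ∃ w ∈ B, V x y z w ∧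
      FewCommon A τ x y G ∧ FewCommon A τ z w G} (crossPairs A B) := by
  intro G H h
  simp only [Set.mem_ofPred_eq]
  refine exists_congr fun x => and_congr_right fun hx => exists_congr fun y =>
    and_congr_right fun hy => exists_congr fun z => and_congr_right fun hz =>
    exists_congr fun w => and_congr_right fun hw => and_congr_right fun _ => and_congr
      (determinedBy_fewCommon τ hx hy G H h) (determinedBy_fewCommon τ hz hw G H h)

lemma disjoint_insidePairs_crossPairs {A B : Finset (Fin n)} (hAB : Disjoint A B) :
    Disjoint (insidePairs B) (crossPairs A B) := by
  rw [Set.disjoint_left]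
  rintro e he ⟨a, ha, b, hb, rfl⟩
  exact Finset.disjoint_left.mp hAB ha (he a (by simp))

lemma determinedBy_blockEvent (V : Fin n → Fin n → Fin n → Fin n → Prop)
    (A : Finset (Fin n)) (κ τ : ℕ) (B : Finset (Fin n)) :
    DeterminedBy {G | BlockEvent V A κ τ B G} (insidePairs B ∪ crossPairs A B) :=
  ((determinedBy_edgesIn_le B κ).mono Set.subset_union_left).inter
    ((determinedBy_exists_fewCommon V A τ B).mono Set.subset_union_right)

lemma grPr_blockEvent_le {V : Fin n → Fin n → Fin n → Fin n → Prop} {A B : Finset (Fin n)}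
    (κ τ : ℕ) {q : ℝ} (hq0 : 0 ≤ q) (hq1 : q ≤ 1) (hAB : Disjoint A B)
    (hq : ∀ x ∈ B, ∀ y ∈ B, ∀ z ∈ B, ∀ w ∈ B, V x y z w →
      ∀ a ∈ A, grPr n {G | NoCommon a x y z w G} ≤ q) :
    grPr n {G | BlockEvent V A κ τ B G} ≤
      (((B.card.choose 2 + 1 : ℕ) : ℝ) ^ κ * (1 / 2) ^ (B.card.choose 2)) *
        ((B.card : ℝ) ^ 4 * (((A.card + 1 : ℕ) : ℝ) ^ (2 * τ) * q ^ (A.card - 2 * τ))) := by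
  have h := grPr_inter_eq_mul (determinedBy_edgesIn_le B κ)
    (determinedBy_exists_fewCommon V A τ B) (disjoint_insidePairs_crossPairs hAB)
  change grPr n ({G | edgesIn G B ≤ κ} ∩ _) ≤ _
  refine h.le.trans (mul_le_mul (grPr_edgesIn_le B κ) ?_ (grPr_nonneg _) (by positivity))
  refine (grPr_le_card_mul (((B ×ˢ B) ×ˢ (B ×ˢ B)).filter
      fun p => V p.1.1 p.1.2 p.2.1 p.2.2)
    (fun p => {G | FewCommon A τ p.1.1 p.1.2 G ∧ FewCommon A τ p.2.1 p.2.2 G}) _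
    (((A.card + 1 : ℕ) : ℝ) ^ (2 * τ) * q ^ (A.card - 2 * τ)) ?_ ?_).trans ?_
  · rintro G ⟨x, hx, y, hy, z, hz, w, hw, hV, hG⟩
    exact ⟨((x, y), (z, w)), by simp [*], hG⟩
  · rintro ⟨⟨x, y⟩, z, w⟩ hp
    simp only [Finset.mem_filter, Finset.mem_product] at hp
    obtain ⟨⟨⟨hx, hy⟩, hz, hw⟩, hV⟩ := hp
    exact grPr_fewCommon_le τ hq0 hq1 hx hy hz hw hAB (hq x hx y hy z hz w hw hV)
  · gcongr
    have h1 := Finset.card_filter_le ((B ×ˢ B) ×ˢ (B ×ˢ B)) fun p => V p.1.1 p.1.2 p.2.1 p.2.2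
    rw [Finset.card_product, Finset.card_product] at h1
    calc _ ≤ ((B.card * B.card * (B.card * B.card) : ℕ) : ℝ) := by exact_mod_cast h1
      _ = _ := by push_cast; ring

/-- A light `a`-set `A` together with `T` disjoint light `b`-sets as in `BlockEvent`. -/
def CoverEvent (V : Fin n → Fin n → Fin n → Fin n → Prop) (a b κ τ T : ℕ)
    (G : SimpleGraph (Fin n)) : Prop :=
  ∃ A : Finset (Fin n), A.card = a ∧ edgesIn G A ≤ κ ∧ ∃ S : Finset (Finset (Fin n)),
    S.card = T ∧ (S : Set (Finset (Fin n))).PairwiseDisjoint id ∧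
    ∀ B ∈ S, B.card = b ∧ Disjoint A B ∧ BlockEvent V A κ τ B G

lemma disjoint_blockPairs {A B B' : Finset (Fin n)} (hAB : Disjoint A B) (hAB' : Disjoint A B')
    (h : Disjoint B B') :
    Disjoint (insidePairs B ∪ crossPairs A B) (insidePairs B' ∪ crossPairs A B') := by
  rw [Finset.disjoint_left] at hAB hAB' h
  rw [Set.disjoint_left]
  rintro e (he | ⟨a, ha, b, hb, rfl⟩) (he' | ⟨a', ha', b', hb', he'⟩)
  · induction e with
    | _ x y => exact h (he x (by simp)) (he' x (by simp))
  · subst he'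
    exact hAB ha' (he a' (by simp))
  · exact hAB' ha (he' a (by simp))
  · rw [Sym2.eq_iff] at he'
    rcases he' with ⟨_, h2⟩ | ⟨h2, _⟩
    · exact h hb (h2 ▸ hb')
    · exact hAB' ha (h2 ▸ hb')

lemma disjoint_insidePairs_blockPairs {A B : Finset (Fin n)} (hAB : Disjoint A B) :
    Disjoint (insidePairs A) (insidePairs B ∪ crossPairs A B) := by
  rw [Finset.disjoint_left] at hAB
  rw [Set.disjoint_left]
  rintro e he (he' | ⟨a, ha, b, hb, rfl⟩)
  · induction e with
    | _ x y => exact hAB (he x (by simp)) (he' x (by simp))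
  · exact hAB (he b (by simp)) hb

lemma grPr_light_inter_blocks_le {V : Fin n → Fin n → Fin n → Fin n → Prop}
    {A : Finset (Fin n)} {S : Finset (Finset (Fin n))} {b : ℕ}
    (κ τ : ℕ) {q : ℝ} (hq0 : 0 ≤ q) (hq1 : q ≤ 1)
    (hS : (S : Set (Finset (Fin n))).PairwiseDisjoint id)
    (hSA : ∀ B ∈ S, B.card = b ∧ Disjoint A B)
    (hq : ∀ a x y z w, a ≠ x → a ≠ y → a ≠ z → a ≠ w → V x y z w →
      grPr n {G | NoCommon a x y z w G} ≤ q) :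
    grPr n {G | edgesIn G A ≤ κ ∧ ∀ B ∈ S, BlockEvent V A κ τ B G} ≤
      (((A.card.choose 2 + 1 : ℕ) : ℝ) ^ κ * (1 / 2) ^ (A.card.choose 2)) *
      ((((b.choose 2 + 1 : ℕ) : ℝ) ^ κ * (1 / 2) ^ (b.choose 2)) *
        ((b : ℝ) ^ 4 * (((A.card + 1 : ℕ) : ℝ) ^ (2 * τ) * q ^ (A.card - 2 * τ)))) ^ S.card := by
  have heq : {G : SimpleGraph (Fin n) | edgesIn G A ≤ κ ∧ ∀ B ∈ S, BlockEvent V A κ τ B G} =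
      {G | edgesIn G A ≤ κ} ∩ ⋂ B ∈ S, {G | BlockEvent V A κ τ B G} := by
    ext G
    simp
  have hdet : DeterminedBy (⋂ B ∈ S, {G : SimpleGraph (Fin n) | BlockEvent V A κ τ B G})
      (⋃ B ∈ S, (insidePairs B ∪ crossPairs A B)) :=
    DeterminedBy.biInter fun B hB => (determinedBy_blockEvent V A κ τ B).mono
      (Set.subset_biUnion_of_mem (u := fun B => insidePairs B ∪ crossPairs A B) hB)
  have hdisj : Disjoint (insidePairs A) (⋃ B ∈ S, (insidePairs B ∪ crossPairs A B)) := by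
    rw [Set.disjoint_iUnion₂_right]
    exact fun B hB => disjoint_insidePairs_blockPairs (hSA B hB).2
  rw [heq, grPr_inter_eq_mul (determinedBy_edgesIn_le A κ) hdet hdisj,
    grPr_biInter_eq_prod S _ (fun B => insidePairs B ∪ crossPairs A B)
      (fun B _ => determinedBy_blockEvent V A κ τ B)
      (fun B hB B' hB' hne => disjoint_blockPairs (hSA B hB).2 (hSA B' hB').2 (hS hB hB' hne)),
    ← Finset.prod_const]
  refine mul_le_mul (grPr_edgesIn_le A κ) (Finset.prod_le_prod (fun B _ => grPr_nonneg _) ?_)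
    (Finset.prod_nonneg fun B _ => grPr_nonneg _) (by positivity)
  intro B hB
  obtain ⟨rfl, hAB⟩ := hSA B hB
  refine grPr_blockEvent_le κ τ hq0 hq1 hAB ?_
  intro x hx y hy z hz w hw hV a ha
  have hne : ∀ b ∈ B, a ≠ b := fun b hb h => Finset.disjoint_left.mp hAB ha (h ▸ hb)
  exact hq a x y z w (hne x hx) (hne y hy) (hne z hz) (hne w hw) hV

lemma grPr_coverEvent_le {V : Fin n → Fin n → Fin n → Fin n → Prop} (a b κ τ T : ℕ) {q : ℝ}
    (hq0 : 0 ≤ q) (hq1 : q ≤ 1)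
    (hq : ∀ a x y z w, a ≠ x → a ≠ y → a ≠ z → a ≠ w → V x y z w →
      grPr n {G | NoCommon a x y z w G} ≤ q) :
    grPr n {G | CoverEvent V a b κ τ T G} ≤
      (expY n a * ((a.choose 2 + 1 : ℕ) : ℝ) ^ κ) *
      ((expY n b * ((b.choose 2 + 1 : ℕ) : ℝ) ^ κ) *
        ((b : ℝ) ^ 4 * (((a + 1 : ℕ) : ℝ) ^ (2 * τ) * q ^ (a - 2 * τ)))) ^ T := by
  set c : ℝ := (((a.choose 2 + 1 : ℕ) : ℝ) ^ κ * (1 / 2) ^ (a.choose 2)) *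
      ((((b.choose 2 + 1 : ℕ) : ℝ) ^ κ * (1 / 2) ^ (b.choose 2)) *
        ((b : ℝ) ^ 4 * (((a + 1 : ℕ) : ℝ) ^ (2 * τ) * q ^ (a - 2 * τ)))) ^ T with hc
  refine (grPr_le_card_mul
    ((Finset.univ.powersetCard a ×ˢ (Finset.univ.powersetCard b).powersetCard T).filter
      fun p : Finset (Fin n) × Finset (Finset (Fin n)) =>
        (p.2 : Set (Finset (Fin n))).PairwiseDisjoint id ∧ ∀ B ∈ p.2, Disjoint p.1 B)
    (fun p => {G | edgesIn G p.1 ≤ κ ∧ ∀ B ∈ p.2, BlockEvent V p.1 κ τ B G}) _ c ?_ ?_).trans ?_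
  · rintro G ⟨A, hA, hAκ, S, hS, hSd, hSB⟩
    refine ⟨(A, S), ?_, hAκ, fun B hB => (hSB B hB).2.2⟩
    simp only [Finset.mem_filter, Finset.mem_product, Finset.mem_powersetCard,
      Finset.subset_univ, true_and]
    refine ⟨⟨hA, fun B hB => ?_, hS⟩, hSd, fun B hB => (hSB B hB).2.1⟩
    simpa using (hSB B hB).1
  · rintro ⟨A, S⟩ hp
    simp only [Finset.mem_filter, Finset.mem_product, Finset.mem_powersetCard,
      Finset.subset_univ, true_and] at hp
    obtain ⟨⟨hA, hSb, hS⟩, hSd, hSA⟩ := hp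
    have := grPr_light_inter_blocks_le (V := V) (A := A) (S := S) (b := b) κ τ hq0 hq1 hSd
      (fun B hB => ⟨by simpa using hSb hB, hSA B hB⟩) hq
    rwa [hA, hS] at this
  · have hcard := Finset.card_filter_le
      (Finset.univ.powersetCard a ×ˢ (Finset.univ.powersetCard b).powersetCard T)
      fun p : Finset (Fin n) × Finset (Finset (Fin n)) =>
        (p.2 : Set (Finset (Fin n))).PairwiseDisjoint id ∧ ∀ B ∈ p.2, Disjoint p.1 B
    simp only [Finset.card_product, Finset.card_powersetCard, Finset.card_univ,
      Fintype.card_fin] at hcard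
    have hcard' : ((n.choose a * (n.choose b).choose T : ℕ) : ℝ) ≤
        (n.choose a : ℝ) * (n.choose b : ℝ) ^ T := by
      exact_mod_cast Nat.mul_le_mul_left _ (Nat.choose_le_pow _ _)
    have hc0 : 0 ≤ c := by positivity
    refine (mul_le_mul_of_nonneg_right ((Nat.cast_le.mpr hcard).trans hcard') hc0).trans
      (le_of_eq ?_)
    rw [hc, expY, expY, mul_mul_mul_comm, ← mul_pow]
    simp only [one_div]
    simp only [div_eq_mul_inv, ← inv_pow]
    ring

lemma grPr_noCommon_self_le {a x y : Fin n} (hax : a ≠ x) (hay : a ≠ y) (hxy : x ≠ y) :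
    grPr n {G | NoCommon a x y x y G} ≤ 3 / 4 := by
  have h1 : {G : SimpleGraph (Fin n) | NoCommon a x y x y G} =
      ({G | s(a, x) ∈ G.edgeSet} ∩ {G | s(a, y) ∈ G.edgeSet})ᶜ := by
    ext G
    simp [NoCommon]
  rw [h1, grPr_compl, grPr_inter_eq_mul (determinedBy_mem_edgeSet _) (determinedBy_mem_edgeSet _),
    grPr_mem_edgeSet (by simpa using hax), grPr_mem_edgeSet (by simpa using hay)]
  · norm_num
  · rw [Set.disjoint_singleton, ne_eq, Sym2.eq_iff]
    tauto

lemma grPr_noCommon_star_le {a x y w : Fin n} (hax : a ≠ x) (hay : a ≠ y) (haw : a ≠ w)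
    (hxy : x ≠ y) (hxw : x ≠ w) (hyw : y ≠ w) :
    grPr n {G | NoCommon a x y x w G} ≤ 5 / 8 := by
  have h1 : {G : SimpleGraph (Fin n) | NoCommon a x y x w G} =
      ({G | s(a, x) ∈ G.edgeSet} ∩ ({G | s(a, y) ∈ G.edgeSet}ᶜ ∩ {G | s(a, w) ∈ G.edgeSet}ᶜ)ᶜ)ᶜ := by
    ext G
    simp [NoCommon]
    tauto
  have h2 : DeterminedBy ({G | s(a, y) ∈ G.edgeSet}ᶜ ∩ {G | s(a, w) ∈ G.edgeSet}ᶜ)ᶜ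
      {s(a, y), s(a, w)} :=
    (((determinedBy_mem_edgeSet _).mono (by simp)).compl.inter
      ((determinedBy_mem_edgeSet _).mono (by simp)).compl).compl
  rw [h1, grPr_compl, grPr_inter_eq_mul (determinedBy_mem_edgeSet _) h2, grPr_compl,
    grPr_inter_eq_mul (determinedBy_mem_edgeSet _).compl (determinedBy_mem_edgeSet _).compl,
    grPr_compl, grPr_compl, grPr_mem_edgeSet (by simpa using hax),
    grPr_mem_edgeSet (by simpa using hay), grPr_mem_edgeSet (by simpa using haw)]
  · norm_num
  · rw [Set.disjoint_singleton, ne_eq, Sym2.eq_iff]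
    tauto
  · rw [Set.disjoint_singleton_left, Set.mem_insert_iff, Set.mem_singleton_iff, Sym2.eq_iff,
      Sym2.eq_iff]
    tauto

lemma grPr_noCommon_matching_le {a x y z w : Fin n} (hax : a ≠ x) (hay : a ≠ y) (haz : a ≠ z)
    (haw : a ≠ w) (hxy : x ≠ y) (hzw : z ≠ w) (hxz : x ≠ z) (hxw : x ≠ w) (hyz : y ≠ z)
    (hyw : y ≠ w) : grPr n {G | NoCommon a x y z w G} ≤ 5 / 8 := by
  have h1 : {G : SimpleGraph (Fin n) | NoCommon a x y z w G} =
      {G | NoCommon a x y x y G} ∩ {G | NoCommon a z w z w G} := by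
    ext G
    simp [NoCommon]
  rw [h1, grPr_inter_eq_mul (D := crossPairs {a} {x, y}) (D' := crossPairs {a} {z, w})
    (determinedBy_noCommon (by simp) (by simp) (by simp) (by simp))
    (determinedBy_noCommon (by simp) (by simp) (by simp) (by simp))]
  · have := mul_le_mul (grPr_noCommon_self_le hax hay hxy) (grPr_noCommon_self_le haz haw hzw)
      (grPr_nonneg _) (by norm_num)
    linarith
  · rw [Set.disjoint_left]
    rintro e ⟨a₁, h₁, b, hb, rfl⟩ ⟨a₂, h₂, b', hb', he⟩
    simp only [Finset.mem_insert, Finset.mem_singleton] at h₁ h₂ hb hb'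
    subst h₁ h₂
    rw [Sym2.eq_iff] at he
    rcases hb with rfl | rfl <;> rcases hb' with rfl | rfl <;> simp_all

lemma noCommon_swap_left (a x y z w : Fin n) (G : SimpleGraph (Fin n)) :
    NoCommon a x y z w G ↔ NoCommon a y x z w G := by
  simp only [NoCommon, and_comm]

lemma noCommon_swap_right (a x y z w : Fin n) (G : SimpleGraph (Fin n)) :
    NoCommon a x y z w G ↔ NoCommon a x y w z G := by
  simp only [NoCommon, and_comm]

lemma grPr_noCommon_le {a x y z w : Fin n} (hax : a ≠ x) (hay : a ≠ y) (haz : a ≠ z)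
    (haw : a ≠ w) (hxy : x ≠ y) (hzw : z ≠ w) (hne : s(x, y) ≠ s(z, w)) :
    grPr n {G | NoCommon a x y z w G} ≤ 5 / 8 := by
  have hne' : ¬ ((x = z ∧ y = w) ∨ (x = w ∧ y = z)) := fun h => hne (Sym2.eq_iff.mpr h)
  by_cases hxz : x = z
  · subst hxz
    exact grPr_noCommon_star_le hax hay haw hxy hzw (by tauto)
  by_cases hxw : x = w
  · subst hxw
    simp only [noCommon_swap_right a x y z x]
    exact grPr_noCommon_star_le hax hay haz hxy (Ne.symm hzw) (by tauto)
  by_cases hyz : y = z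
  · subst hyz
    simp only [noCommon_swap_left a x y y w]
    exact grPr_noCommon_star_le hay hax haw hxy.symm hzw (by tauto)
  by_cases hyw : y = w
  · subst hyw
    simp only [noCommon_swap_left a x y z y, noCommon_swap_right a y x z y]
    exact grPr_noCommon_star_le hay hax haz hxy.symm hzw.symm (by tauto)
  exact grPr_noCommon_matching_le hax hay haz haw hxy hzw hxz hxw hyz hyw

end Probability

section Extraction

variable {n : ℕ}

/-- The two pairs coincide and are nondegenerate. -/
def SamePair (x y z w : Fin n) : Prop := x ≠ y ∧ z = x ∧ w = y

/-- The two pairs are distinct and nondegenerate. -/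
def DistinctPairs (x y z w : Fin n) : Prop := x ≠ y ∧ z ≠ w ∧ s(x, y) ≠ s(z, w)

/-- If a family of `β` indices has fibres of size at most `μ` and `β > 1 + (μ + 1) ρ`, then
either more than `ρ` fibres have two elements, or there are at least `2 ρ + 2` fibres. -/
lemma many_large_fibres_or_many_fibres {ι α : Type*} [Fintype ι] [DecidableEq α] (f : ι → α)
    {μ ρ : ℕ}
    (hμ : ∀ i, (Finset.univ.filter fun j => f j = f i).card ≤ μ)
    (h : 1 + (μ + 1) * ρ < Fintype.card ι) :
    ρ + 1 ≤ ((Finset.univ.image f).filter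
      fun b => 2 ≤ (Finset.univ.filter fun j => f j = b).card).card ∨
    2 * ρ + 2 ≤ (Finset.univ.image f).card := by
  rw [or_iff_not_imp_left]
  intro hlt
  set I := Finset.univ.image f with hI
  set J := I.filter fun b => 2 ≤ (Finset.univ.filter fun j => f j = b).card with hJ
  have hpos : 0 < Fintype.card ι := by lia
  obtain ⟨i⟩ := Fintype.card_pos_iff.mp hpos
  have hμ1 : 1 ≤ μ := le_trans (Finset.card_pos.mpr ⟨i, by simp⟩) (hμ i)
  have hsum : Fintype.card ι = ∑ b ∈ I, (Finset.univ.filter fun j => f j = b).card := by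
    rw [← Finset.card_univ]
    exact Finset.card_eq_sum_card_image f Finset.univ
  have hle : Fintype.card ι ≤ I.card + J.card * (μ - 1) := by
    rw [hsum, hJ, Finset.card_filter, Finset.sum_mul, Finset.card_eq_sum_ones,
      ← Finset.sum_add_distrib]
    refine Finset.sum_le_sum fun b hb => ?_
    obtain ⟨j, -, rfl⟩ := Finset.mem_image.mp hb
    have := hμ j
    split_ifs <;> lia
  obtain ⟨m, rfl⟩ := Nat.exists_eq_add_of_le hμ1
  have hJρ : J.card * (1 + m - 1) ≤ ρ * m := by
    rw [Nat.add_sub_cancel_left]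
    exact Nat.mul_le_mul_right _ (by lia)
  have hexp : (1 + m + 1) * ρ = 2 * ρ + ρ * m := by ring
  lia

lemma coverEvent_of_badCoverEvent {k μ ρ β : ℕ} (hβ : 1 + (μ + 1) * ρ < β)
    {G : SimpleGraph (Fin n)} (hG : BadCoverEvent n k μ ρ β G) :
    CoverEvent DistinctPairs (k - ρ) (k + 1) ⌊(k : ℝ) ^ (3 / 4 : ℝ)⌋₊ ⌊(k : ℝ) ^ (2 / 3 : ℝ)⌋₊
      (ρ + 1) G ∨
    CoverEvent SamePair (k - ρ) (k + 1) ⌊(k : ℝ) ^ (3 / 4 : ℝ)⌋₊ ⌊(k : ℝ) ^ (2 / 3 : ℝ)⌋₊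
      (2 * ρ + 2) G := by
  obtain ⟨A, hA, hAl, As, u, v, hadj, hdist, hAs, hdisj, hμ, hfew⟩ := hG
  have hfew' : ∀ i, FewCommon A ⌊(k : ℝ) ^ (2 / 3 : ℝ)⌋₊ (u i) (v i) G :=
    fun i => Nat.le_floor (hfew i)
  have hfib : ∀ i, (Finset.univ.filter fun j => As j = As i).card ≤ μ := by
    refine fun i => (Finset.card_le_card fun j hj => ?_).trans (hμ i)
    simp only [Finset.mem_filter, Finset.mem_univ, true_and] at hj ⊢
    exact ⟨hj ▸ (hAs j).1, hj ▸ (hAs j).2.1⟩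
  have hpd : ((Finset.univ.image As : Finset (Finset (Fin n))) :
      Set (Finset (Fin n))).PairwiseDisjoint id := by
    intro B hB B' hB' hne
    simp only [Finset.coe_image, Finset.coe_univ, Set.image_univ, Set.mem_range] at hB hB'
    obtain ⟨i, rfl⟩ := hB
    obtain ⟨j, rfl⟩ := hB'
    exact (hdisj i j).resolve_left hne
  refine (many_large_fibres_or_many_fibres As hfib (by simpa using hβ)).imp ?_ ?_
  · intro h
    obtain ⟨S, hS, hScard⟩ := Finset.exists_subset_card_eq h
    refine ⟨A, hA, Nat.le_floor hAl, S, hScard,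
      hpd.subset (Finset.coe_subset.mpr (hS.trans (Finset.filter_subset _ _))), fun B hB => ?_⟩
    have hB2 := (Finset.mem_filter.mp (hS hB)).2
    obtain ⟨i, hi, j, hj, hij⟩ := Finset.one_lt_card.mp hB2
    simp only [Finset.mem_filter, Finset.mem_univ, true_and] at hi hj
    subst hi
    refine ⟨(hAs i).2.2.1, (hAs i).2.2.2.2, Nat.le_floor (hAs i).2.2.2.1, u i, (hAs i).1, v i,
      (hAs i).2.1, u j, hj ▸ (hAs j).1, v j, hj ▸ (hAs j).2.1, ?_, hfew' i, hfew' j⟩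
    exact ⟨(hadj i).1.ne, (hadj j).1.ne, hdist i j hij⟩
  · intro h
    obtain ⟨S, hS, hScard⟩ := Finset.exists_subset_card_eq h
    refine ⟨A, hA, Nat.le_floor hAl, S, hScard, hpd.subset (Finset.coe_subset.mpr hS),
      fun B hB => ?_⟩
    obtain ⟨i, -, rfl⟩ := Finset.mem_image.mp (hS hB)
    exact ⟨(hAs i).2.2.1, (hAs i).2.2.2.2, Nat.le_floor (hAs i).2.2.2.1, u i, (hAs i).1, v i,
      (hAs i).2.1, u i, (hAs i).1, v i, (hAs i).2.1, ⟨(hadj i).1.ne, rfl, rfl⟩, hfew' i, hfew' i⟩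

end Extraction

section Estimates

lemma expY_nonneg (n k : ℕ) : 0 ≤ expY n k := by unfold expY; positivity

lemma expY_succ {n s : ℕ} (hs : s ≤ n) :
    expY n (s + 1) * ((s + 1) * 2 ^ s) = expY n s * ((n : ℝ) - s) := by
  have h : ((n.choose (s + 1) * (s + 1) : ℕ) : ℝ) = ((n.choose s * (n - s) : ℕ) : ℝ) :=
    congrArg _ (Nat.choose_succ_right_eq n s)
  push_cast [Nat.cast_sub hs] at h
  have h2 : (s + 1).choose 2 = s + s.choose 2 := by simp [Nat.choose_succ_succ]
  unfold expY
  rw [h2, pow_add]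
  field_simp
  linarith

lemma expY_succ_le {n k : ℕ} (hk : k ≤ n) : expY n (k + 1) ≤ expY n k * (n / 2 ^ k) := by
  have h := expY_succ hk
  have h0 := expY_nonneg n (k + 1)
  have h1 := expY_nonneg n k
  have hp : (0 : ℝ) < 2 ^ k := by positivity
  rw [← mul_div_assoc, le_div_iff₀ hp]
  have hk0 : (0 : ℝ) ≤ k := Nat.cast_nonneg k
  nlinarith [mul_nonneg (mul_nonneg h0 hk0) hp.le, mul_nonneg h1 hk0]

lemma expY_sub_le {n k : ℕ} (hkn : 2 * k ≤ n) (hn : 0 < n) {ρ : ℕ} (hρ : ρ ≤ k) :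
    expY n (k - ρ) ≤ expY n k * (2 * k * 2 ^ k / n) ^ ρ := by
  induction ρ with
  | zero => simp
  | succ ρ ih =>
    obtain ⟨s, hs⟩ : ∃ s, k - (ρ + 1) = s := ⟨_, rfl⟩
    have hs' : k - ρ = s + 1 := by lia
    have hstep : expY n s ≤ expY n (s + 1) * (2 * k * 2 ^ k / n) := by
      have h := expY_succ (n := n) (s := s) (by lia)
      have h0 := expY_nonneg n s
      have h1 := expY_nonneg n (s + 1)
      have hn' : (0 : ℝ) < n := by exact_mod_cast hn
      have hsn : 2 * (s : ℝ) ≤ n := by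
        have : 2 * s ≤ n := by lia
        exact_mod_cast this
      have hsk : (s : ℝ) + 1 ≤ k := by
        have : s + 1 ≤ k := by lia
        exact_mod_cast this
      have hpow : (2 : ℝ) ^ s ≤ 2 ^ k := pow_le_pow_right₀ (by norm_num) (by lia)
      rw [← mul_div_assoc, le_div_iff₀ hn']
      calc expY n s * n ≤ 2 * (expY n s * ((n : ℝ) - s)) := by nlinarith
        _ = 2 * (expY n (s + 1) * ((s + 1) * 2 ^ s)) := by rw [h]
        _ ≤ 2 * (expY n (s + 1) * (k * 2 ^ k)) := by gcongr
        _ = _ := by ring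
    rw [hs, pow_succ, ← mul_assoc]
    refine hstep.trans ?_
    rw [← hs']
    gcongr
    exact ih (by lia)

/-- A combination of the factors in `grPr_coverEvent_le`, with all of them bounded by powers of
two. -/
lemma cover_product_le {n k ρ κ τ T : ℕ} {q c ℓ : ℝ} (hq0 : 0 ≤ q)
    (hqc : ∀ m : ℕ, q ^ m ≤ (2 : ℝ) ^ (-(c * m))) (hc0 : 0 ≤ c) (hc1 : c ≤ 1)
    (hcT : 0.65 * ((ρ : ℝ) + 1) ≤ T * (c - 0.01))
    (hn : (n : ℝ) = 2 ^ ℓ) (hkℓ : |(k : ℝ) - 2 * ℓ| ≤ k / 1000)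
    (hρ : (ρ : ℝ) ≤ k / 2000) (hτ : 2 * (τ : ℝ) ≤ k / 2000) (hτκ : τ ≤ κ)
    (hκ : (((k + 1) ^ 2 : ℕ) : ℝ) ^ κ ≤ 2 ^ ((k : ℝ) / 1000))
    (hk4 : ((k : ℝ) + 1) ^ 4 ≤ 2 ^ ((k : ℝ) / 1000))
    (hY : expY n k ≤ (n : ℝ) ^ (1 + 1 / 1000 : ℝ)) :
    (expY n (k - ρ) * (((k - ρ).choose 2 + 1 : ℕ) : ℝ) ^ κ) *
      ((expY n (k + 1) * (((k + 1).choose 2 + 1 : ℕ) : ℝ) ^ κ) *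
        (((k + 1 : ℕ) : ℝ) ^ 4 * (((k - ρ + 1 : ℕ) : ℝ) ^ (2 * τ) *
          q ^ (k - ρ - 2 * τ)))) ^ T ≤ 2 ^ (-((k : ℝ) / 10)) := by
  have hk0 : (0 : ℝ) ≤ k := Nat.cast_nonneg k
  have hρ0 : (0 : ℝ) ≤ ρ := Nat.cast_nonneg ρ
  obtain ⟨hℓ1, hℓ2⟩ := abs_le.mp hkℓ
  have hn0 : (0 : ℝ) < n := by rw [hn]; positivity
  have hnpos : 0 < n := by exact_mod_cast hn0
  have hρk : ρ ≤ k := by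
    have : (ρ : ℝ) ≤ k := by linarith
    exact_mod_cast this
  have h2k : 2 * (k : ℝ) ≤ 2 ^ ((k : ℝ) / 1000) := by
    refine le_trans ?_ hk4
    nlinarith [sq_nonneg ((k : ℝ)), sq_nonneg ((k : ℝ) ^ 2), pow_nonneg hk0 3]
  have hkn : 2 * k ≤ n := by
    have : 2 * (k : ℝ) ≤ n := by
      rw [hn]
      exact h2k.trans (Real.rpow_le_rpow_of_exponent_le (by norm_num) (by linarith))
    exact_mod_cast this
  have hY' : expY n k ≤ 2 ^ (0.502 * (k : ℝ)) := by
    refine hY.trans ?_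
    rw [hn, ← Real.rpow_mul (by norm_num)]
    exact Real.rpow_le_rpow_of_exponent_le (by norm_num) (by linarith)
  have hpowk : (2 : ℝ) ^ k = 2 ^ (k : ℝ) := (Real.rpow_natCast 2 k).symm
  have hYs : expY n (k + 1) ≤ 2 ^ (0.003 * (k : ℝ)) := by
    refine (expY_succ_le (by lia)).trans ?_
    calc expY n k * (n / 2 ^ k) ≤ 2 ^ (0.502 * (k : ℝ)) * (n / 2 ^ k) := by gcongr
      _ = 2 ^ (0.502 * (k : ℝ) + (ℓ - k)) := by
        rw [hn, hpowk, ← Real.rpow_sub (by norm_num), ← Real.rpow_add (by norm_num)]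
      _ ≤ _ := Real.rpow_le_rpow_of_exponent_le (by norm_num) (by linarith)
  have hYρ : expY n (k - ρ) ≤ 2 ^ (0.502 * (k : ℝ) + 0.502 * k * ρ) := by
    refine (expY_sub_le hkn hnpos hρk).trans ?_
    rw [Real.rpow_add (by norm_num), Real.rpow_mul (by norm_num) (0.502 * (k : ℝ)),
      Real.rpow_natCast]
    gcongr
    calc 2 * (k : ℝ) * 2 ^ k / n ≤ 2 ^ ((k : ℝ) / 1000) * 2 ^ k / n := by gcongr
      _ = 2 ^ ((k : ℝ) / 1000 + k - ℓ) := by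
        rw [hn, hpowk, Real.rpow_sub (by norm_num), Real.rpow_add (by norm_num)]
      _ ≤ _ := Real.rpow_le_rpow_of_exponent_le (by norm_num) (by linarith)
  have hlight : ∀ s ≤ k + 1, ((s.choose 2 + 1 : ℕ) : ℝ) ^ κ ≤ 2 ^ ((k : ℝ) / 1000) := by
    intro s hs
    refine le_trans ?_ hκ
    gcongr
    rcases Nat.eq_zero_or_pos s with rfl | hs0
    · simpa using Nat.one_le_pow 2 (k + 1) (by lia)
    · have h1 : s.choose 2 < s ^ 2 := by
        rw [Nat.choose_two_right]
        calc s * (s - 1) / 2 ≤ s * (s - 1) := Nat.div_le_self _ _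
          _ < s * s := Nat.mul_lt_mul_of_pos_left (by lia) hs0
          _ = s ^ 2 := (sq s).symm
      exact h1.trans_le (Nat.pow_le_pow_left hs 2)
  have hSτ : ((k - ρ + 1 : ℕ) : ℝ) ^ (2 * τ) ≤ 2 ^ ((k : ℝ) / 1000) := by
    refine le_trans ?_ hκ
    rw [pow_mul]
    push_cast
    calc ((((k - ρ : ℕ) : ℝ) + 1) ^ 2) ^ τ ≤ (((k : ℝ) + 1) ^ 2) ^ τ := by
          gcongr
          lia
      _ ≤ (((k : ℝ) + 1) ^ 2) ^ κ := pow_le_pow_right₀ (by nlinarith) hτκ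
  have hqk : q ^ (k - ρ - 2 * τ) ≤ 2 ^ (-(c * k) + 0.001 * k) := by
    refine (hqc _).trans (Real.rpow_le_rpow_of_exponent_le (by norm_num) ?_)
    have : (k : ℝ) - ρ - 2 * τ ≤ ((k - ρ - 2 * τ : ℕ) : ℝ) := by
      have : k ≤ (k - ρ - 2 * τ) + ρ + 2 * τ := by lia
      have : (k : ℝ) ≤ ((k - ρ - 2 * τ : ℕ) : ℝ) + ρ + 2 * τ := by exact_mod_cast this
      linarith
    nlinarith
  have hblock : (expY n (k + 1) * (((k + 1).choose 2 + 1 : ℕ) : ℝ) ^ κ) *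
        (((k + 1 : ℕ) : ℝ) ^ 4 * (((k - ρ + 1 : ℕ) : ℝ) ^ (2 * τ) *
          q ^ (k - ρ - 2 * τ))) ≤ 2 ^ (-((c - 0.01) * k)) := by
    calc _ ≤ ((2 : ℝ) ^ (0.003 * (k : ℝ)) * 2 ^ ((k : ℝ) / 1000)) * (2 ^ ((k : ℝ) / 1000) *
          (2 ^ ((k : ℝ) / 1000) * 2 ^ (-(c * k) + 0.001 * k))) := by
          have hk4' : ((k + 1 : ℕ) : ℝ) ^ 4 ≤ 2 ^ ((k : ℝ) / 1000) := by exact_mod_cast hk4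
          have h1 := hlight (k + 1) le_rfl
          gcongr
      _ = 2 ^ (0.003 * (k : ℝ) + (k : ℝ) / 1000 +
          ((k : ℝ) / 1000 + ((k : ℝ) / 1000 + (-(c * k) + 0.001 * k)))) := by
          simp only [Real.rpow_add (by norm_num : (0 : ℝ) < 2)]
      _ ≤ _ := Real.rpow_le_rpow_of_exponent_le (by norm_num) (by linarith)
  have hB0 : 0 ≤ (expY n (k + 1) * (((k + 1).choose 2 + 1 : ℕ) : ℝ) ^ κ) *
        (((k + 1 : ℕ) : ℝ) ^ 4 * (((k - ρ + 1 : ℕ) : ℝ) ^ (2 * τ) * q ^ (k - ρ - 2 * τ))) := by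
    have := expY_nonneg n (k + 1)
    positivity
  calc _ ≤ ((2 : ℝ) ^ (0.502 * (k : ℝ) + 0.502 * k * ρ) * 2 ^ ((k : ℝ) / 1000)) *
        ((2 : ℝ) ^ (-((c - 0.01) * k))) ^ T := by
        have h1 := hlight (k - ρ) (by lia)
        gcongr
    _ = 2 ^ ((0.502 * (k : ℝ) + 0.502 * k * ρ + (k : ℝ) / 1000) + -((c - 0.01) * k) * T) := by
        rw [← Real.rpow_natCast (_ ^ _) T, ← Real.rpow_mul (by norm_num),
          ← Real.rpow_add (by norm_num), ← Real.rpow_add (by norm_num)]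
    _ ≤ _ := by
        apply Real.rpow_le_rpow_of_exponent_le (by norm_num)
        have := mul_le_mul_of_nonneg_left hcT hk0
        have := mul_nonneg hk0 hρ0
        linarith

lemma pow_le_two_rpow_of_pow_hundred_le {q : ℝ} (hq0 : 0 ≤ q) {j : ℕ}
    (h : q ^ 100 ≤ (1 / 2) ^ j) (m : ℕ) : q ^ m ≤ (2 : ℝ) ^ (-((j : ℝ) / 100 * m)) := by
  have h1 : q ≤ (2 : ℝ) ^ (-((j : ℝ) / 100)) := by
    refine le_of_pow_le_pow_left₀ (n := 100) (by norm_num) (by positivity) (h.trans (le_of_eq ?_))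
    rw [← Real.rpow_natCast (_ ^ _), ← Real.rpow_mul (by norm_num), one_div, inv_pow,
      ← Real.rpow_natCast, ← Real.rpow_neg (by norm_num)]
    congr 1
    push_cast
    ring
  calc q ^ m ≤ ((2 : ℝ) ^ (-((j : ℝ) / 100))) ^ m := pow_le_pow_left₀ hq0 h1 m
    _ = _ := by
      rw [← Real.rpow_natCast, ← Real.rpow_mul (by norm_num)]
      congr 1
      ring

lemma eventually_mul_rpow_le {a c s : ℝ} (hc : 0 < c) (hs : s < 1) :
    ∀ᶠ k : ℕ in Filter.atTop, a * (k : ℝ) ^ s ≤ c * k := by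
  have h : ∀ᶠ k : ℕ in Filter.atTop, a / c ≤ (k : ℝ) ^ (1 - s) :=
    ((tendsto_rpow_atTop (by linarith : 0 < 1 - s)).comp
      tendsto_natCast_atTop_atTop).eventually_ge_atTop _
  filter_upwards [h, Filter.eventually_gt_atTop 0] with k hk hk0
  have hk0' : (0 : ℝ) < k := by exact_mod_cast hk0
  rw [div_le_iff₀ hc] at hk
  calc a * (k : ℝ) ^ s ≤ (k : ℝ) ^ (1 - s) * c * (k : ℝ) ^ s := by gcongr
    _ = c * ((k : ℝ) ^ (1 - s) * (k : ℝ) ^ s) := by ring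
    _ = c * k := by rw [← Real.rpow_add hk0']; simp

lemma eventually_pow_floor_le :
    ∀ᶠ k : ℕ in Filter.atTop,
      (((k + 1) ^ 2 : ℕ) : ℝ) ^ ⌊(k : ℝ) ^ (3 / 4 : ℝ)⌋₊ ≤ 2 ^ ((k : ℝ) / 1000) := by
  filter_upwards [eventually_mul_rpow_le (a := 32) (c := Real.log 2 / 1000) (s := 7 / 8)
    (by have := Real.log_pos one_lt_two; positivity) (by norm_num),
    Filter.eventually_ge_atTop 1] with k hk hk1
  have hk1' : (1 : ℝ) ≤ k := by exact_mod_cast hk1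
  have hlog : Real.log ((k : ℝ) + 1) ≤ 16 * (k : ℝ) ^ (1 / 8 : ℝ) := by
    calc Real.log ((k : ℝ) + 1) ≤ ((k : ℝ) + 1) ^ (1 / 8 : ℝ) / (1 / 8) :=
          Real.log_le_rpow_div (by positivity) (by norm_num)
      _ ≤ (2 * k : ℝ) ^ (1 / 8 : ℝ) / (1 / 8) := by gcongr; linarith
      _ = 8 * ((2 : ℝ) ^ (1 / 8 : ℝ) * (k : ℝ) ^ (1 / 8 : ℝ)) := by
          rw [Real.mul_rpow (by norm_num) (by positivity)]
          ring
      _ ≤ 8 * ((2 : ℝ) ^ (1 : ℝ) * (k : ℝ) ^ (1 / 8 : ℝ)) := by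
          gcongr <;> norm_num
      _ = _ := by rw [Real.rpow_one]; ring
  have hlog0 : 0 ≤ Real.log ((k : ℝ) + 1) := Real.log_nonneg (by linarith)
  rw [← Real.log_le_log_iff (by positivity) (by positivity), Real.log_pow,
    Real.log_rpow (by norm_num)]
  push_cast
  rw [Real.log_pow]
  calc (⌊(k : ℝ) ^ (3 / 4 : ℝ)⌋₊ : ℝ) * ((2 : ℕ) * Real.log ((k : ℝ) + 1))
      ≤ (k : ℝ) ^ (3 / 4 : ℝ) * ((2 : ℕ) * (16 * (k : ℝ) ^ (1 / 8 : ℝ))) := by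
        gcongr
        exact Nat.floor_le (by positivity)
    _ = 32 * ((k : ℝ) ^ (3 / 4 : ℝ) * (k : ℝ) ^ (1 / 8 : ℝ)) := by push_cast; ring
    _ = 32 * (k : ℝ) ^ (7 / 8 : ℝ) := by
        rw [← Real.rpow_add (by linarith)]
        norm_num
    _ ≤ _ := hk
    _ = _ := by ring

lemma eventually_mul_log_log_le (c : ℝ) :
    ∀ᶠ n : ℕ in Filter.atTop, c * Real.log (Real.log n) ≤ Real.logb 2 n := by
  have h := Real.isLittleO_log_id_atTop.comp_tendsto
    (Real.tendsto_log_atTop.comp tendsto_natCast_atTop_atTop)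
  filter_upwards [h.def (inv_pos.mpr (by positivity : 0 < |c| + 1)),
    Filter.eventually_ge_atTop 1] with n hn hn1
  simp only [Function.comp_apply, id_eq, Real.norm_eq_abs] at hn
  have hlog0 : 0 ≤ Real.log n := Real.log_nonneg (by exact_mod_cast hn1)
  rw [abs_of_nonneg hlog0, inv_mul_eq_div, le_div_iff₀ (by positivity)] at hn
  have h2 : Real.log n ≤ Real.logb 2 n := by
    rw [Real.logb, le_div_iff₀ (Real.log_pos one_lt_two)]
    nlinarith [Real.log_two_lt_d9]
  have h3 : c * Real.log (Real.log n) ≤ |c| * |Real.log (Real.log n)| := by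
    rw [← abs_mul]
    exact le_abs_self _
  nlinarith [abs_nonneg (Real.log (Real.log n))]

end Estimates

theorem stmt18 (C ε : ℝ) (hC : 0 < C) (hε : 0 < ε) :
    ∃ ε₀ : ℝ, 0 < ε₀ ∧ ∃ δ : ℝ, 0 < δ ∧ ∃ N : ℕ, ∀ n : ℕ, N ≤ n → ∀ k r μ ρ β : ℕ,
      |(k : ℝ) - 2 * Real.logb 2 n| ≤ C * Real.log (Real.log n) →
      expY n k ≤ (n : ℝ) ^ (1 + δ) →
      2 ≤ r →
      (r : ℝ) ≤ ε₀ * Real.log (Real.log n) / Real.log (Real.log (Real.log n)) →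
      μ < r → ρ ≤ r - 2 → β ≤ r ^ 2 → 1 + (μ + 1) * ρ < β →
      grPr n {G | BadCoverEvent n k μ ρ β G} ≤ (n : ℝ) ^ (-(1 / 8 : ℝ) + ε) := by
  refine ⟨1, one_pos, 1 / 1000, by norm_num, ?_⟩
  have hbig : ∀ᶠ k : ℕ in Filter.atTop,
      (((k + 1) ^ 2 : ℕ) : ℝ) ^ ⌊(k : ℝ) ^ (3 / 4 : ℝ)⌋₊ ≤ 2 ^ ((k : ℝ) / 1000) ∧
      2 * (k : ℝ) ^ (2 / 3 : ℝ) ≤ 1 / 2000 * k ∧ 100 ≤ k :=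
    eventually_pow_floor_le.and ((eventually_mul_rpow_le (by norm_num) (by norm_num)).and
      (Filter.eventually_ge_atTop 100))
  obtain ⟨K, hK⟩ := Filter.eventually_atTop.mp hbig
  have hlogn : Filter.Tendsto (fun n : ℕ => Real.log n) Filter.atTop Filter.atTop :=
    Real.tendsto_log_atTop.comp tendsto_natCast_atTop_atTop
  have hlog3 : Filter.Tendsto (fun n : ℕ => Real.log (Real.log (Real.log n))) Filter.atTop
      Filter.atTop := Real.tendsto_log_atTop.comp (Real.tendsto_log_atTop.comp hlogn)
  have hlogb : Filter.Tendsto (fun n : ℕ => Real.logb 2 n) Filter.atTop Filter.atTop :=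
    (Real.tendsto_logb_atTop one_lt_two).comp tendsto_natCast_atTop_atTop
  refine Filter.eventually_atTop.mp ?_
  filter_upwards [eventually_mul_log_log_le (2000 * C), eventually_mul_log_log_le 10000,
    hlog3.eventually_ge_atTop 1, hlogb.eventually_ge_atTop (K : ℝ),
    hlogb.eventually_ge_atTop 0, (Real.tendsto_log_atTop.comp hlogn).eventually_ge_atTop 0,
    Filter.eventually_ge_atTop 1] with n hn1 hn2 hn3 hn4 hn5 hn6 hnpos
  intro k r μ ρ β hkn hY _ hr _ hρr _ hβ
  set ℓ := Real.logb 2 n with hℓ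
  have hn : (n : ℝ) = 2 ^ ℓ :=
    (Real.rpow_logb (by norm_num) (by norm_num) (by exact_mod_cast hnpos)).symm
  have hkℓ' : |(k : ℝ) - 2 * ℓ| ≤ ℓ / 2000 := by linarith
  obtain ⟨hk1, hk2⟩ := abs_le.mp hkℓ'
  have hKk : K ≤ k := by
    have : (K : ℝ) ≤ k := by linarith
    exact_mod_cast this
  obtain ⟨hκ, hτ, hk100⟩ := hK k hKk
  have hk100' : (100 : ℝ) ≤ k := by exact_mod_cast hk100
  have hkℓ : |(k : ℝ) - 2 * ℓ| ≤ k / 1000 := by linarith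
  have hρ : (ρ : ℝ) ≤ k / 2000 := by
    have h1 : (ρ : ℝ) ≤ r := by
      have : ρ ≤ r := by lia
      exact_mod_cast this
    have h2 : 1 * Real.log (Real.log n) / Real.log (Real.log (Real.log n)) ≤
        Real.log (Real.log n) := by
      rw [one_mul]
      exact div_le_self hn6 hn3
    linarith
  set κ := ⌊(k : ℝ) ^ (3 / 4 : ℝ)⌋₊
  set τ := ⌊(k : ℝ) ^ (2 / 3 : ℝ)⌋₊
  have hτ' : 2 * (τ : ℝ) ≤ k / 2000 := by
    have : (τ : ℝ) ≤ (k : ℝ) ^ (2 / 3 : ℝ) := Nat.floor_le (by positivity)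
    linarith
  have hτκ : τ ≤ κ := Nat.floor_le_floor
    (Real.rpow_le_rpow_of_exponent_le (by linarith) (by norm_num))
  have hκ2 : 2 ≤ κ := by
    refine Nat.le_floor ?_
    calc ((2 : ℕ) : ℝ) ≤ 100 ^ (1 / 2 : ℝ) := by
          rw [← Real.sqrt_eq_rpow]
          exact Real.le_sqrt_of_sq_le (by norm_num)
      _ ≤ (k : ℝ) ^ (1 / 2 : ℝ) := by gcongr
      _ ≤ _ := Real.rpow_le_rpow_of_exponent_le (by linarith) (by norm_num)
  have hk4 : ((k : ℝ) + 1) ^ 4 ≤ 2 ^ ((k : ℝ) / 1000) := by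
    refine le_trans ?_ hκ
    push_cast
    rw [← pow_mul]
    exact pow_le_pow_right₀ (by linarith) (by lia)
  have hρ0 : (0 : ℝ) ≤ ρ := Nat.cast_nonneg ρ
  have hE₁ : grPr n {G | CoverEvent DistinctPairs (k - ρ) (k + 1) κ τ (ρ + 1) G} ≤
      2 ^ (-((k : ℝ) / 10)) := by
    refine (grPr_coverEvent_le (q := 5 / 8) (k - ρ) (k + 1) κ τ (ρ + 1) (by norm_num) (by norm_num)
      fun a x y z w hax hay haz haw hV => grPr_noCommon_le hax hay haz haw hV.1 hV.2.1 hV.2.2).trans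
      (cover_product_le (c := (67 : ℕ) / 100) (by norm_num)
        (pow_le_two_rpow_of_pow_hundred_le (by norm_num) (by norm_num)) (by norm_num)
        (by norm_num) ?_ hn hkℓ hρ hτ' hτκ hκ hk4 hY)
    push_cast
    linarith
  have hE₂ : grPr n {G | CoverEvent SamePair (k - ρ) (k + 1) κ τ (2 * ρ + 2) G} ≤
      2 ^ (-((k : ℝ) / 10)) := by
    refine (grPr_coverEvent_le (q := 3 / 4) (k - ρ) (k + 1) κ τ (2 * ρ + 2) (by norm_num)
      (by norm_num) ?_).trans
      (cover_product_le (c := (41 : ℕ) / 100) (by norm_num)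
        (pow_le_two_rpow_of_pow_hundred_le (by norm_num) (by norm_num)) (by norm_num)
        (by norm_num) ?_ hn hkℓ hρ hτ' hτκ hκ hk4 hY)
    · rintro a x y z w hax hay - - ⟨hxy, rfl, rfl⟩
      exact grPr_noCommon_self_le hax hay hxy
    · push_cast
      linarith
  have hsub : {G : SimpleGraph (Fin n) | BadCoverEvent n k μ ρ β G} ⊆
      {G | CoverEvent DistinctPairs (k - ρ) (k + 1) κ τ (ρ + 1) G} ∪
      {G | CoverEvent SamePair (k - ρ) (k + 1) κ τ (2 * ρ + 2) G} :=
    fun G hG => coverEvent_of_badCoverEvent hβ hG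
  calc grPr n {G | BadCoverEvent n k μ ρ β G}
      ≤ 2 ^ (-((k : ℝ) / 10)) + 2 ^ (-((k : ℝ) / 10)) :=
        (grPr_mono hsub).trans ((grPr_union_le _ _).trans (add_le_add hE₁ hE₂))
    _ = 2 ^ (1 + -((k : ℝ) / 10)) := by
        rw [Real.rpow_add (by norm_num), Real.rpow_one]
        ring
    _ ≤ (2 : ℝ) ^ (ℓ * (-(1 / 8 : ℝ) + ε)) := by
        apply Real.rpow_le_rpow_of_exponent_le (by norm_num)
        have := mul_nonneg hn5 hε.le
        linarith
    _ = (n : ℝ) ^ (-(1 / 8 : ℝ) + ε) := by rw [hn, ← Real.rpow_mul (by norm_num)]
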